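/- For a symmetric positive definite d×d matrix Σ with nonnegative entries and α ∈ (0,1), the function x ↦ E[α(X−x)₊ᵀΣ(X−x)₊ + (1−α)(X−x)₋ᵀΣ(X−x)₋] is strictly convex on ℝ^d, where X is a random vector with E[|X_i X_j|] < ∞ for all i,j; hence the Σ-expectile e_α^Σ(X) is uniquely defined. -/

import Mathlib

open MeasureTheory Matrix

lemma StrictConvexOn.integral {Ω E : Type*} [MeasurableSpace Ω] {μ : Measure Ω} [NeZero μ]
    [AddCommMonoid E] [Module ℝ E] {s : Set E} {f : Ω → E → ℝ}
    (hs : Convex ℝ s) (hf : ∀ ω, StrictConvexOn ℝ s (f ω))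
    (hint : ∀ x ∈ s, Integrable (fun ω => f ω x) μ) :
    StrictConvexOn ℝ s (fun x => ∫ ω, f ω x ∂μ) := by
  refine ⟨hs, fun x hx y hy hxy a b ha hb hab => ?_⟩
  have hz := hint _ (hs hx hy ha.le hb.le hab)
  have hr : Integrable (fun ω => a • f ω x + b • f ω y) μ :=
    ((hint x hx).smul a).add ((hint y hy).smul b)
  have hlt : ∀ ω, f ω (a • x + b • y) < a • f ω x + b • f ω y :=
    fun ω => (hf ω).2 hx hy hxy ha hb hab
  have hsum : ∫ ω, (a • f ω x + b • f ω y) ∂μ = a • ∫ ω, f ω x ∂μ + b • ∫ ω, f ω y ∂μ := by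
    simpa only [Pi.add_apply, Pi.smul_apply, integral_smul] using
      integral_add ((hint x hx).smul a) ((hint y hy).smul b)
  have hpos : 0 < ∫ ω, (a • f ω x + b • f ω y - f ω (a • x + b • y)) ∂μ := by
    rw [integral_pos_iff_support_of_nonneg (fun ω => (sub_pos.2 (hlt ω)).le) (hr.sub hz)]
    have : Function.support (fun ω => a • f ω x + b • f ω y - f ω (a • x + b • y)) = Set.univ :=
      Set.eq_univ_of_forall fun ω => (sub_pos.2 (hlt ω)).ne'
    rw [this]
    exact Measure.measure_univ_pos.2 (NeZero.ne μ)
  rw [integral_sub hr hz, hsum] at hpos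
  exact sub_pos.1 hpos

namespace Matrix

variable {n : Type*} [Fintype n] {S : Matrix n n ℝ}

lemma PosDef.strictConvexOn_dotProduct_mulVec (hS : S.PosDef) :
    StrictConvexOn ℝ Set.univ (fun u : n → ℝ => u ⬝ᵥ S *ᵥ u) := by
  refine ⟨convex_univ, fun u _ v _ huv a b ha hb hab => ?_⟩
  have hp : 0 < (u - v) ⬝ᵥ S *ᵥ (u - v) := by
    simpa using hS.dotProduct_mulVec_pos (sub_ne_zero.2 huv)
  obtain rfl : b = 1 - a := by linarith
  have := mul_pos (mul_pos ha hb) hp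
  simp only [mulVec_sub, mulVec_add, mulVec_smul, dotProduct_sub, sub_dotProduct, dotProduct_add,
    add_dotProduct, dotProduct_smul, smul_dotProduct, smul_eq_mul] at this ⊢
  linarith

lemma dotProduct_mulVec_mono_of_nonneg (hpos : ∀ i j, 0 ≤ S i j) {u v : n → ℝ}
    (hu : 0 ≤ u) (huv : u ≤ v) : u ⬝ᵥ S *ᵥ u ≤ v ⬝ᵥ S *ᵥ v := by
  simp only [dotProduct, mulVec]
  refine Finset.sum_le_sum fun i _ => mul_le_mul (huv i)
    (Finset.sum_le_sum fun j _ => mul_le_mul_of_nonneg_left (huv j) (hpos i j))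
    (Finset.sum_nonneg fun j _ => mul_nonneg (hpos i j) (hu j)) ((hu i).trans (huv i))

lemma PosDef.exists_sum_sq_le_dotProduct_mulVec (hS : S.PosDef) (hpos : ∀ i j, 0 ≤ S i j) :
    ∃ c > 0, ∀ u : n → ℝ, 0 ≤ u → c * ∑ i, u i ^ 2 ≤ u ⬝ᵥ S *ᵥ u := by
  have hc : ∃ c > 0, ∀ i, c ≤ S i i := by
    cases isEmpty_or_nonempty n
    · exact ⟨1, one_pos, isEmptyElim⟩
    · obtain ⟨i, hi⟩ := Finite.exists_min fun i => S i i
      exact ⟨S i i, hS.diag_pos, hi⟩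
  obtain ⟨c, hc0, hc⟩ := hc
  refine ⟨c, hc0, fun u hu => ?_⟩
  simp only [dotProduct, mulVec, Finset.mul_sum]
  refine Finset.sum_le_sum fun i _ => ?_
  refine le_trans ?_ (Finset.single_le_sum
    (fun j _ => mul_nonneg (hu i) (mul_nonneg (hpos i j) (hu j))) (Finset.mem_univ i))
  nlinarith [mul_le_mul_of_nonneg_right (hc i) (sq_nonneg (u i))]

lemma PosDef.dotProduct_mulVec_le_of_le (hS : S.PosDef) (hpos : ∀ i j, 0 ≤ S i j)
    {u v w : n → ℝ} {a b : ℝ} (ha : 0 < a) (hb : 0 < b) (hab : a + b = 1)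
    (hw : 0 ≤ w) (hwuv : w ≤ a • u + b • v) :
    w ⬝ᵥ S *ᵥ w ≤ a * (u ⬝ᵥ S *ᵥ u) + b * (v ⬝ᵥ S *ᵥ v) :=
  (dotProduct_mulVec_mono_of_nonneg hpos hw hwuv).trans
    (hS.strictConvexOn_dotProduct_mulVec.convexOn.2 trivial trivial ha.le hb.le hab)

lemma PosDef.dotProduct_mulVec_lt_of_le (hS : S.PosDef) (hpos : ∀ i j, 0 ≤ S i j)
    {u v w : n → ℝ} (huv : u ≠ v) {a b : ℝ} (ha : 0 < a) (hb : 0 < b) (hab : a + b = 1)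
    (hw : 0 ≤ w) (hwuv : w ≤ a • u + b • v) :
    w ⬝ᵥ S *ᵥ w < a * (u ⬝ᵥ S *ᵥ u) + b * (v ⬝ᵥ S *ᵥ v) :=
  (dotProduct_mulVec_mono_of_nonneg hpos hw hwuv).trans_lt
    (hS.strictConvexOn_dotProduct_mulVec.2 trivial trivial huv ha hb hab)

lemma PosDef.strictConvexOn_expectileScore (hS : S.PosDef) (hpos : ∀ i j, 0 ≤ S i j)
    {α : ℝ} (hα : α ∈ Set.Ioo (0 : ℝ) 1) (z : n → ℝ) :
    StrictConvexOn ℝ Set.univ (fun x : n → ℝ =>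
      α * ((fun i => max (z i - x i) 0) ⬝ᵥ S *ᵥ (fun i => max (z i - x i) 0))
      + (1 - α) * ((fun i => max (x i - z i) 0) ⬝ᵥ S *ᵥ (fun i => max (x i - z i) 0))) := by
  obtain ⟨hα0, hα1⟩ := hα
  have hα1 := sub_pos.2 hα1
  refine ⟨convex_univ, fun x _ y _ hxy a b ha hb hab => ?_⟩
  have hcomb (p q : ℝ) : max (a * p + b * q) 0 ≤ a * max p 0 + b * max q 0 := by
    refine max_le ?_ (by positivity)
    gcongr <;> exact le_max_left _ _
  have hle₁ : (fun i => max (z i - (a • x + b • y) i) 0) ≤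
      a • (fun i => max (z i - x i) 0) + b • (fun i => max (z i - y i) 0) := fun i => by
    refine le_trans (le_of_eq ?_) (hcomb (z i - x i) (z i - y i))
    simp only [Pi.add_apply, Pi.smul_apply, smul_eq_mul]
    congr 1
    linear_combination -(z i) * hab
  have hle₂ : (fun i => max ((a • x + b • y) i - z i) 0) ≤
      a • (fun i => max (x i - z i) 0) + b • (fun i => max (y i - z i) 0) := fun i => by
    refine le_trans (le_of_eq ?_) (hcomb (x i - z i) (y i - z i))
    simp only [Pi.add_apply, Pi.smul_apply, smul_eq_mul]
    congr 1
    linear_combination z i * hab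
  have hn₁ : 0 ≤ fun i => max (z i - (a • x + b • y) i) 0 := fun i => le_max_right _ _
  have hn₂ : 0 ≤ fun i => max ((a • x + b • y) i - z i) 0 := fun i => le_max_right _ _
  simp only [smul_eq_mul]
  by_cases h : (fun i => max (z i - x i) 0) = fun i => max (z i - y i) 0
  · have h' : (fun i => max (x i - z i) 0) ≠ fun i => max (y i - z i) 0 := fun h' => by
      refine hxy (funext fun i => ?_)
      have e₁ := congrFun h i
      have e₂ := congrFun h' i
      grind
    have h₁ := mul_le_mul_of_nonneg_left
      (hS.dotProduct_mulVec_le_of_le hpos ha hb hab hn₁ hle₁) hα0.le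
    have h₂ := mul_lt_mul_of_pos_left
      (hS.dotProduct_mulVec_lt_of_le hpos h' ha hb hab hn₂ hle₂) hα1
    linarith
  · have h₁ := mul_lt_mul_of_pos_left
      (hS.dotProduct_mulVec_lt_of_le hpos h ha hb hab hn₁ hle₁) hα0
    have h₂ := mul_le_mul_of_nonneg_left
      (hS.dotProduct_mulVec_le_of_le hpos ha hb hab hn₂ hle₂) hα1.le
    linarith

lemma PosDef.exists_le_expectileScore (hS : S.PosDef) (hpos : ∀ i j, 0 ≤ S i j)
    {α : ℝ} (hα : α ∈ Set.Ioo (0 : ℝ) 1) :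
    ∃ c > 0, ∀ z x : n → ℝ, c * ‖x‖ ^ 2 - 2 * c * ∑ i, z i ^ 2 ≤
      α * ((fun i => max (z i - x i) 0) ⬝ᵥ S *ᵥ (fun i => max (z i - x i) 0))
      + (1 - α) * ((fun i => max (x i - z i) 0) ⬝ᵥ S *ᵥ (fun i => max (x i - z i) 0)) := by
  obtain ⟨c, hc, h⟩ := hS.exists_sum_sq_le_dotProduct_mulVec hpos
  have hα1 := sub_pos.2 hα.2
  have hm : 0 < min α (1 - α) := lt_min hα.1 hα1
  refine ⟨min α (1 - α) * c / 2, by positivity, fun z x => ?_⟩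
  have h₁ := h (fun i => max (z i - x i) 0) fun i => le_max_right _ _
  have h₂ := h (fun i => max (x i - z i) 0) fun i => le_max_right _ _
  have hn (w : n → ℝ) : 0 ≤ c * ∑ i, w i ^ 2 := by positivity
  have h₁' := mul_le_mul (min_le_left α (1 - α)) h₁ (hn _) hα.1.le
  have h₂' := mul_le_mul (min_le_right α (1 - α)) h₂ (hn _) hα1.le
  refine le_trans ?_ (add_le_add h₁' h₂')
  have hnorm : ‖x‖ ^ 2 ≤ ∑ i, x i ^ 2 := by
    refine Real.le_sqrt (norm_nonneg _) (by positivity) |>.1 ?_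
    refine (pi_norm_le_iff_of_nonneg (Real.sqrt_nonneg _)).2 fun i => Real.le_sqrt_of_sq_le ?_
    rw [Real.norm_eq_abs, sq_abs]
    exact Finset.single_le_sum (f := fun i => x i ^ 2) (fun i _ => sq_nonneg _) (Finset.mem_univ i)
  have hsum : ∑ i, x i ^ 2 ≤ 2 * (∑ i, max (z i - x i) 0 ^ 2 + ∑ i, max (x i - z i) 0 ^ 2)
      + 2 * ∑ i, z i ^ 2 := by
    rw [← Finset.sum_add_distrib, Finset.mul_sum, Finset.mul_sum, ← Finset.sum_add_distrib]
    refine Finset.sum_le_sum fun i _ => ?_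
    rcases le_total (z i) (x i) with hzx | hzx
    · rw [max_eq_right (sub_nonpos.2 hzx), max_eq_left (sub_nonneg.2 hzx)]
      nlinarith [sq_nonneg (x i - 2 * z i)]
    · rw [max_eq_left (sub_nonneg.2 hzx), max_eq_right (sub_nonpos.2 hzx)]
      nlinarith [sq_nonneg (x i - 2 * z i)]
  have := mul_le_mul_of_nonneg_left (hnorm.trans hsum) (mul_pos hm hc).le
  linarith

end Matrix

lemma MeasureTheory.MemLp.integrable_dotProduct_mulVec {Ω n : Type*} [MeasurableSpace Ω]
    [Fintype n] {μ : Measure Ω} (S : Matrix n n ℝ) {Y : Ω → n → ℝ}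
    (hY : ∀ i, MemLp (fun ω => Y ω i) 2 μ) :
    Integrable (fun ω => Y ω ⬝ᵥ S *ᵥ Y ω) μ := by
  simp only [dotProduct, mulVec, Finset.mul_sum]
  refine integrable_finsetSum _ fun i _ => integrable_finsetSum _ fun j _ => ?_
  exact (hY i).integrable_mul ((hY j).const_mul (S i j))


open MeasureTheory Matrix

theorem sigma_expectile_score_strictConvex_unique
    {Ω : Type*} [MeasurableSpace Ω] (μ : Measure Ω) [IsProbabilityMeasure μ]
    {d : ℕ} (S : Matrix (Fin d) (Fin d) ℝ) (hS : S.PosDef) (hpos : ∀ i j, 0 ≤ S i j)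
    (X : Ω → Fin d → ℝ) (hm : Measurable X)
    (hint : ∀ i j, Integrable (fun ω => |X ω i * X ω j|) μ)
    (α : ℝ) (hα : α ∈ Set.Ioo (0:ℝ) 1) :
    StrictConvexOn ℝ Set.univ
      (fun x : Fin d → ℝ => ∫ ω,
        α * ((fun i => max (X ω i - x i) 0) ⬝ᵥ S.mulVec (fun i => max (X ω i - x i) 0))
        + (1-α) * ((fun i => max (x i - X ω i) 0) ⬝ᵥ S.mulVec (fun i => max (x i - X ω i) 0)) ∂μ) ∧
    ∃! e : Fin d → ℝ, IsMinOn
      (fun x : Fin d → ℝ => ∫ ω,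
        α * ((fun i => max (X ω i - x i) 0) ⬝ᵥ S.mulVec (fun i => max (X ω i - x i) 0))
        + (1-α) * ((fun i => max (x i - X ω i) 0) ⬝ᵥ S.mulVec (fun i => max (x i - X ω i) 0)) ∂μ)
      Set.univ e := by
  have hsq (i : Fin d) : Integrable (fun ω => X ω i ^ 2) μ :=
    (hint i i).congr (.of_forall fun ω => by simp [sq])
  have hX (i : Fin d) : MemLp (fun ω => X ω i) 2 μ :=
    (memLp_two_iff_integrable_sq (by fun_prop)).2 (hsq i)
  have hscore (x : Fin d → ℝ) := ((MemLp.integrable_dotProduct_mulVec S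
    fun i => ((hX i).sub (memLp_const (x i))).pos_part).const_mul α).add
    ((MemLp.integrable_dotProduct_mulVec S
      fun i => ((memLp_const (x i)).sub (hX i)).pos_part).const_mul (1 - α))
  have hconv := StrictConvexOn.integral (μ := μ) convex_univ
    (fun ω => hS.strictConvexOn_expectileScore hpos hα (X ω)) fun x _ => hscore x
  refine ⟨hconv, ?_⟩
  obtain ⟨c, hc, hle⟩ := hS.exists_le_expectileScore hpos hα
  have hsqsum : Integrable (fun ω => 2 * c * ∑ i, X ω i ^ 2) μ :=
    (integrable_finsetSum _ fun i _ => hsq i).const_mul _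
  have hcont := continuousOn_univ.1 (hconv.convexOn.continuousOn isOpen_univ)
  obtain ⟨e, he⟩ := hcont.exists_forall_le (by
    refine Filter.tendsto_atTop_mono (fun x => ?_) <| Filter.tendsto_atTop_add_const_right _
      (-∫ ω, 2 * c * ∑ i, X ω i ^ 2 ∂μ) <|
      ((Filter.tendsto_pow_atTop two_ne_zero).comp
        (tendsto_norm_cocompact_atTop (E := Fin d → ℝ))).const_mul_atTop hc
    have := integral_mono ((integrable_const (c * ‖x‖ ^ 2)).sub hsqsum) (hscore x)
      fun ω => hle (X ω) x
    rw [integral_sub' (integrable_const _) hsqsum] at this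
    simpa [← sub_eq_add_neg] using this)
  exact ⟨e, fun x _ => he x, fun y hy =>
    hconv.eq_of_isMinOn hy (fun x _ => he x) trivial trivial⟩
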